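/- Let n be an odd prime and let A be the (n-1)×(n-1) matrix over ℚ with entries A_{ij} = ⟨ij/n⟩ for 1 ≤ i, j ≤ n-1. Then the rank of A equals (n+1)/2; equivalently, the kernel of A (as a linear map ℚ^{n-1} → ℚ^{n-1}) has dimension (n-3)/2. -/

import Mathlib

open Complex HurwitzZeta Filter Topology

lemma cc_bound (n : ℕ) (s : ℝ) (h1 : 1 ≤ s) (h2 : s ≤ 2) :
    ‖((1:ℂ) / ((n + 1 : ℕ) : ℂ) ^ (s : ℂ) - 1 / (n : ℂ) ^ (s : ℂ))‖ ≤ 4 * (1 / ((n + 1 : ℕ) : ℝ) ^ 2) := by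
  rcases Nat.eq_zero_or_pos n with rfl | hn
  · have : (s : ℂ) ≠ 0 := by exact_mod_cast (by linarith : s ≠ 0)
    simp [this]
  have hn0 : (1:ℝ) ≤ n := by exact_mod_cast hn
  have e : ((1:ℂ) / ((n + 1 : ℕ) : ℂ) ^ (s : ℂ) - 1 / (n : ℂ) ^ (s : ℂ))
      = ((1 / ((n + 1 : ℕ) : ℝ) ^ s - 1 / (n : ℝ) ^ s : ℝ) : ℂ) := by
    push_cast
    rw [ofReal_cpow (by positivity), ofReal_cpow (by positivity)]
    push_cast
    rfl
  rw [e, norm_real, Real.norm_eq_abs, abs_sub_comm]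
  have hle : 1 / ((n + 1 : ℕ) : ℝ) ^ s ≤ 1 / (n : ℝ) ^ s := by
    gcongr
    linarith
  rw [abs_of_nonneg (by linarith)]
  have hb := one_add_mul_self_le_rpow_one_add (s := -(1 / ((n + 1 : ℕ) : ℝ))) (p := s)
    (by rw [neg_le_neg_iff, div_le_one (by positivity)]; push_cast; linarith) h1
  have hq : 1 + -(1 / ((n + 1 : ℕ) : ℝ)) = (n : ℝ) / ((n + 1 : ℕ) : ℝ) := by
    push_cast
    field_simp
    ring
  rw [hq, Real.div_rpow (by positivity) (by positivity)] at hb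
  have hp : (n : ℝ) ≤ (n : ℝ) ^ s := by
    simpa using Real.rpow_le_rpow_of_exponent_le hn0 h1
  have hpos : 0 < (n : ℝ) ^ s := by positivity
  have hpos' : 0 < ((n + 1 : ℕ) : ℝ) ^ s := by positivity
  have e2 : 1 / (n : ℝ) ^ s - 1 / ((n + 1 : ℕ) : ℝ) ^ s
      = (1 / (n : ℝ) ^ s) * (1 - (n : ℝ) ^ s / ((n + 1 : ℕ) : ℝ) ^ s) := by
    field_simp
  rw [e2]
  calc (1 / (n : ℝ) ^ s) * (1 - (n : ℝ) ^ s / ((n + 1 : ℕ) : ℝ) ^ s)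
      ≤ (1 / (n : ℝ) ^ s) * (2 * (1 / ((n + 1 : ℕ) : ℝ))) := by
        apply mul_le_mul_of_nonneg_left _ (by positivity)
        have : s * (1 / ((n + 1 : ℕ) : ℝ)) ≤ 2 * (1 / ((n + 1 : ℕ) : ℝ)) := by gcongr
        linarith
    _ ≤ (1 / (n : ℝ)) * (2 * (1 / ((n + 1 : ℕ) : ℝ))) := by gcongr
    _ ≤ _ := by
        push_cast
        rw [div_mul_eq_mul_div, div_le_iff₀ (by positivity)]
        field_simp
        linarith

lemma cc_summable : Summable (fun n : ℕ => 4 * (1 / ((n + 1 : ℕ) : ℝ) ^ 2)) :=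
  ((summable_nat_add_iff 1).2 (Real.summable_one_div_nat_pow.2 one_lt_two)).mul_left 4

lemma shift_hasSum (z : ℂ) (d : ℕ → ℂ) (hd : d 0 = 0) (E : ℂ)
    (h : HasSum (fun n : ℕ => z ^ n * d n) E) :
    HasSum (fun n : ℕ => z ^ (n + 1) * (d (n + 1) - d n)) ((1 - z) * E) := by
  have h1 : HasSum (fun n : ℕ => z ^ (n + 1) * d (n + 1)) E := by
    rw [hasSum_nat_add_iff (f := fun n => z ^ n * d n) 1]
    simpa [hd] using h
  have h2 := h1.sub (h.mul_left z)
  convert! h2 using 1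
  · ext n; ring
  · ring

lemma expZeta_one (a : ℝ) (ha : (a : UnitAddCircle) ≠ 0) (hz : cexp (2 * Real.pi * I * a) ≠ 1) :
    expZeta a 1 = - log (1 - cexp (2 * Real.pi * I * a)) := by
  set z := cexp (2 * Real.pi * I * a) with hzdef
  have hn : ‖z‖ = 1 := by
    rw [hzdef, show (2 * Real.pi * I * a : ℂ) = ((2 * Real.pi * a : ℝ) : ℂ) * I by push_cast; ring]
    exact norm_exp_ofReal_mul_I _
  have hz' : 1 - z ≠ 0 := sub_ne_zero.2 (Ne.symm hz)
  set G : ℂ := ∑' n : ℕ, z ^ (n + 1) * (1 / ((n + 1 : ℕ) : ℂ) - 1 / (n : ℂ))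
  have A1 : Tendsto (fun s : ℝ => (1 - z) * expZeta a s) (𝓝[>] 1) (𝓝 ((1 - z) * expZeta a 1)) := by
    apply Tendsto.const_mul
    have hc : ContinuousAt (fun s : ℝ => expZeta a (s : ℂ)) 1 := by
      have := (differentiable_expZeta_of_ne_zero ha).continuous
      fun_prop
    have := hc.tendsto
    rw [ofReal_one] at this
    exact this.mono_left nhdsWithin_le_nhds
  have A2 : Tendsto (fun s : ℝ => (1 - z) * expZeta a s) (𝓝[>] 1) (𝓝 G) := by
    have key : Tendsto (fun s : ℝ => ∑' n : ℕ, z ^ (n + 1) *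
        (1 / ((n + 1 : ℕ) : ℂ) ^ (s : ℂ) - 1 / (n : ℂ) ^ (s : ℂ))) (𝓝[>] 1) (𝓝 G) := by
      apply tendsto_tsum_of_dominated_convergence cc_summable
      · intro n
        apply Tendsto.const_mul
        apply Tendsto.mono_left _ nhdsWithin_le_nhds
        have aux : ∀ m : ℕ, Tendsto (fun s : ℝ => 1 / (m : ℂ) ^ (s : ℂ)) (𝓝 1) (𝓝 (1 / (m : ℂ))) := by
          intro m
          rcases Nat.eq_zero_or_pos m with rfl | hm
          · have : (fun s : ℝ => 1 / ((0 : ℕ) : ℂ) ^ (s : ℂ)) =ᶠ[𝓝 1] fun _ => 1 / ((0 : ℕ) : ℂ) := by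
              filter_upwards [lt_mem_nhds (show (0 : ℝ) < 1 by norm_num)] with s hs
              have : (s : ℂ) ≠ 0 := by exact_mod_cast hs.ne'
              simp [this]
            exact tendsto_const_nhds.congr' this.symm
          · have hm' : (m : ℂ) ≠ 0 := by exact_mod_cast hm.ne'
            have : ContinuousAt (fun s : ℝ => 1 / (m : ℂ) ^ (s : ℂ)) 1 := by
              apply ContinuousAt.div continuousAt_const
              · exact (ContinuousAt.const_cpow (by fun_prop) (Or.inl hm'))
              · simp [hm']
            simpa using this.tendsto
        exact (aux (n + 1)).sub (aux n)
      · filter_upwards [self_mem_nhdsWithin, mem_nhdsWithin_of_mem_nhds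
          (gt_mem_nhds (show (1 : ℝ) < 2 by norm_num))] with s hs1 hs2 n
        rw [norm_mul, norm_pow, hn, one_pow, one_mul]
        exact cc_bound n s (le_of_lt hs1) hs2.le
    refine key.congr' ?_
    filter_upwards [self_mem_nhdsWithin] with s hs
    have hs' : (1 : ℝ) < s := hs
    have hs0 : (s : ℂ) ≠ 0 := by exact_mod_cast (by linarith : s ≠ 0)
    refine (shift_hasSum z (fun n => 1 / (n : ℂ) ^ (s : ℂ)) (by simp [hs0]) (expZeta a s) ?_).tsum_eq
    have := hasSum_expZeta_of_one_lt_re a (s := s) (by simpa using hs')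
    convert! this using 2 with n
    rw [hzdef, ← Complex.exp_nat_mul, mul_one_div]
    congr 2
    ring
  have B1 : Tendsto (fun r : ℝ => (1 - r * z) * (- log (1 - r * z))) (𝓝[<] 1)
      (𝓝 ((1 - z) * (- log (1 - z)))) := by
    apply Tendsto.mono_left _ nhdsWithin_le_nhds
    have hs : 1 - z ∈ slitPlane := by
      left
      have : z.re < 1 := by
        rcases lt_or_eq_of_le ((re_le_norm z).trans hn.le) with h | h
        · exact h
        · exfalso
          apply hz
          have h2 := Complex.sq_norm z
          rw [hn, normSq_apply, h] at h2
          have : z.im = 0 := by nlinarith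
          exact Complex.ext (by simpa using h) (by simpa using this)
      simpa using this
    have : ContinuousAt (fun r : ℝ => (1 - r * z) * (- log (1 - r * z))) 1 := by
      apply ContinuousAt.mul (by fun_prop)
      apply ContinuousAt.neg
      apply ContinuousAt.clog (by fun_prop)
      simpa using hs
    simpa using this.tendsto
  have B2 : Tendsto (fun r : ℝ => (1 - r * z) * (- log (1 - r * z))) (𝓝[<] 1) (𝓝 G) := by
    have key : Tendsto (fun r : ℝ => ∑' n : ℕ, (r * z) ^ (n + 1) *
        (1 / ((n + 1 : ℕ) : ℂ) - 1 / (n : ℂ))) (𝓝[<] 1) (𝓝 G) := by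
      apply tendsto_tsum_of_dominated_convergence cc_summable
      · intro n
        apply Tendsto.mul_const
        apply Tendsto.mono_left _ nhdsWithin_le_nhds
        have : ContinuousAt (fun r : ℝ => (r * z) ^ (n + 1)) 1 := by fun_prop
        simpa using this.tendsto
      · filter_upwards [self_mem_nhdsWithin, mem_nhdsWithin_of_mem_nhds
          (lt_mem_nhds (show (0 : ℝ) < 1 by norm_num))] with r hr1 hr0 n
        have h := cc_bound n 1 le_rfl one_le_two
        simp only [ofReal_one, cpow_one] at h
        rw [norm_mul, norm_pow, norm_mul, hn, mul_one, norm_real, Real.norm_eq_abs, abs_of_pos hr0]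
        exact (mul_le_of_le_one_left (norm_nonneg _) (pow_le_one₀ hr0.le (le_of_lt hr1))).trans h
    refine key.congr' ?_
    filter_upwards [self_mem_nhdsWithin, mem_nhdsWithin_of_mem_nhds
          (lt_mem_nhds (show (0 : ℝ) < 1 by norm_num))] with r hr1 hr0
    refine (shift_hasSum (r * z) (fun n => 1 / (n : ℂ)) (by simp) _ ?_).tsum_eq
    have := hasSum_taylorSeries_neg_log (z := r * z) (by
      rw [norm_mul, hn, mul_one, norm_real, Real.norm_eq_abs, abs_of_pos hr0]; exact hr1)
    simpa [mul_one_div, div_eq_mul_inv] using this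
  exact mul_left_cancel₀ hz' ((tendsto_nhds_unique A1 A2).trans (tendsto_nhds_unique B1 B2).symm)

lemma log_one_sub_exp (t : ℝ) (h0 : 0 < t) (h1 : t < 1) :
    log (1 - cexp (2 * Real.pi * I * t)) =
      Real.log (2 * Real.sin (Real.pi * t)) + (Real.pi * (t - 1 / 2) : ℝ) * I := by
  have hs : 0 < Real.sin (Real.pi * t) :=
    Real.sin_pos_of_pos_of_lt_pi (by positivity) (by nlinarith [Real.pi_pos])
  have e : 1 - cexp (2 * Real.pi * I * t) =
      ((2 * Real.sin (Real.pi * t) : ℝ) : ℂ) * cexp ((Real.pi * (t - 1 / 2) : ℝ) * I) := by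
    have h2 : ((Real.pi * (t - 1 / 2) : ℝ) : ℂ) * I = (Real.pi * t : ℂ) * I - Real.pi / 2 * I := by
      push_cast; ring
    rw [h2, Complex.exp_sub, Complex.exp_pi_div_two_mul_I]
    push_cast
    rw [Complex.sin, show (2 * Real.pi * I * t : ℂ) = (Real.pi * t : ℂ) * I + (Real.pi * t : ℂ) * I by ring,
      Complex.exp_add, show -(Real.pi * t : ℂ) * I = -((Real.pi * t : ℂ) * I) by ring, Complex.exp_neg]
    have := Complex.exp_ne_zero ((Real.pi * t : ℂ) * I)
    field_simp
  rw [e, Complex.log_ofReal_mul (by positivity) (Complex.exp_ne_zero _), Complex.log_exp]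
  · simp only [mul_im, ofReal_re, I_im, ofReal_im, I_re]
    nlinarith [Real.pi_pos]
  · simp only [mul_im, ofReal_re, I_im, ofReal_im, I_re]
    nlinarith [Real.pi_pos]

lemma toAddCircle_log {N : ℕ} [NeZero N] (j : ZMod N) (hj : j ≠ 0) :
    expZeta (ZMod.toAddCircle j) 1 =
      - (Real.log (2 * Real.sin (Real.pi * (j.val / N))) + (Real.pi * (j.val / N - 1 / 2) : ℝ) * I) := by
  have hN : (0 : ℝ) < N := by exact_mod_cast Nat.pos_of_ne_zero (NeZero.ne N)
  have hv : (0 : ℝ) < j.val := by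
    exact_mod_cast Nat.pos_of_ne_zero (fun h => hj ((ZMod.val_eq_zero j).1 h))
  have hv' : (j.val : ℝ) < N := by exact_mod_cast ZMod.val_lt j
  have h0 : (0 : ℝ) < j.val / N := by positivity
  have h1 : (j.val / N : ℝ) < 1 := by rwa [div_lt_one hN]
  have hne : ZMod.toAddCircle j ≠ 0 := by rwa [ne_eq, ZMod.toAddCircle_eq_zero]
  rw [ZMod.toAddCircle_apply] at hne ⊢
  rw [expZeta_one _ hne, log_one_sub_exp _ h0 h1]
  intro h
  rw [Complex.exp_eq_one_iff] at h
  obtain ⟨m, hm⟩ := h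
  have h2 : (((j.val / N : ℝ)) : ℂ) = m := by
    have : (2 * Real.pi * I : ℂ) ≠ 0 := by simp [Real.pi_ne_zero]
    apply mul_left_cancel₀ this
    rw [hm]; ring
  have h3 : (j.val / N : ℝ) = m := by exact_mod_cast h2
  rw [h3] at h0 h1
  have : (0 : ℤ) < m := by exact_mod_cast h0
  have : m < (1 : ℤ) := by exact_mod_cast h1
  omega

lemma odd_ne_one {p : ℕ} (χ : DirichletCharacter ℂ p) (h : χ.Odd) : χ ≠ 1 := by
  rintro rfl
  have : (1 : DirichletCharacter ℂ p) (-1) = -1 := h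
  rw [MulChar.one_apply (isUnit_one.neg)] at this
  norm_num at this

lemma bernoulli_ne_zero {p : ℕ} [Fact p.Prime] (χ : DirichletCharacter ℂ p) (h : χ.Odd) :
    ∑ j : ZMod p, χ j * ((j.val : ℂ) / p) ≠ 0 := by
  have h1 := odd_ne_one χ h
  have hp : p.Prime := Fact.out
  have hprim : χ.IsPrimitive := by
    rcases (Nat.dvd_prime hp).1 χ.conductor_dvd_level with h' | h'
    · exact absurd (χ.eq_one_iff_conductor_eq_one.2 h') h1
    · exact h'
  have hg : gaussSum χ (ZMod.stdAddChar (N := p)) ≠ 0 :=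
    gaussSum_ne_zero_of_nontrivial (by simp [hp.ne_zero]) h1 (ZMod.isPrimitive_stdAddChar p)
  have hodd : ∀ j, χ (-j) = - χ j := fun j => by
    rw [← neg_one_mul, map_mul, show χ (-1) = -1 from h, neg_one_mul]
  have hodd' : ∀ j, χ⁻¹ (-j) = - χ⁻¹ j := fun j => by
    rw [MulChar.inv_apply', MulChar.inv_apply', inv_neg, hodd]
  have hχ0 : χ 0 = 0 := MulChar.map_zero χ
  have hF : ZMod.LFunction (ZMod.dft χ) 1 =
      - gaussSum χ (ZMod.stdAddChar (N := p)) * DirichletCharacter.LFunction χ⁻¹ 1 := by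
    have : ZMod.dft χ = fun k => - gaussSum χ (ZMod.stdAddChar (N := p)) * χ⁻¹ k := by
      ext k
      rw [hprim.fourierTransform_eq_inv_mul_gaussSum, hodd']
      ring
    rw [this, DirichletCharacter.LFunction, ZMod.LFunction, ZMod.LFunction, mul_left_comm]
    simp only [Finset.mul_sum]
    congr 1
    ext
    ring
  have hne : ZMod.LFunction (ZMod.dft χ) 1 ≠ 0 := by
    rw [hF]
    exact mul_ne_zero (neg_ne_zero.2 hg)
      (DirichletCharacter.LFunction_apply_one_ne_zero (by simpa using h1))
  rw [ZMod.LFunction_dft _ (Or.inl hχ0)] at hne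
  have hsym : ∑ j : ZMod p, χ j * expZeta (ZMod.toAddCircle (-j)) 1
      = - ∑ j : ZMod p, χ j * expZeta (ZMod.toAddCircle j) 1 := by
    rw [← Finset.sum_neg_distrib]
    refine Fintype.sum_equiv (Equiv.neg _) _ _ fun j => ?_
    simp [hodd]
  have hsum : ∑ j : ZMod p, χ j = 0 := MulChar.sum_eq_zero_of_ne_one h1
  have key : 2 * ∑ j : ZMod p, χ j * expZeta (ZMod.toAddCircle (-j)) 1
      = 2 * Real.pi * I * ∑ j : ZMod p, χ j * ((j.val : ℂ) / p) := by
    rw [two_mul]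
    nth_rw 2 [hsym]
    have : 2 * Real.pi * I * ∑ j : ZMod p, χ j * ((j.val : ℂ) / p) =
       2 * Real.pi * I * ∑ j : ZMod p, χ j * ((j.val : ℂ) / p) - Real.pi * I * ∑ j : ZMod p, χ j := by
      rw [hsum]; ring
    rw [this, ← sub_eq_add_neg, ← Finset.sum_sub_distrib, Finset.mul_sum, Finset.mul_sum,
      ← Finset.sum_sub_distrib]
    refine Finset.sum_congr rfl fun j _ => ?_
    by_cases hj : j = 0
    · simp [hj, hχ0]
    rw [toAddCircle_log j hj, toAddCircle_log (-j) (neg_ne_zero.2 hj)]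
    have hpR : (p : ℝ) ≠ 0 := by exact_mod_cast hp.ne_zero
    have hv : (((-j).val : ℝ) / p) = 1 - j.val / p := by
      haveI : NeZero j := ⟨hj⟩
      rw [ZMod.val_neg_of_ne_zero, Nat.cast_sub (ZMod.val_lt j).le, sub_div, div_self hpR]
    have hs : Real.sin (Real.pi * (1 - j.val / p)) = Real.sin (Real.pi * (j.val / p)) := by
      rw [mul_sub, mul_one, Real.sin_pi_sub]
    rw [hv, hs]
    push_cast
    ring
  intro h0
  rw [h0, mul_zero] at key
  exact hne (by simpa using key)

lemma rank_map_complex {m : Type*} [Fintype m] [DecidableEq m] (M : Matrix m m ℚ) :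
    (M.map (algebraMap ℚ ℂ)).rank = M.rank := by
  classical
  obtain ⟨V, U, e, hV, hU, h⟩ := Matrix.exists_rank_normal_form M
  let f := (algebraMap ℚ ℂ).mapMatrix (m := m)
  have hV' : IsUnit (f V).det := (Matrix.isUnit_iff_isUnit_det _).1 (hV.map f)
  have hU' : IsUnit (f U).det := (Matrix.isUnit_iff_isUnit_det _).1 (hU.map f)
  have h2 : f V * f M * f U = (Matrix.fromBlocks 1 0 0 0).submatrix e e := by
    rw [← map_mul, ← map_mul, h]
    ext i j
    simp only [f, RingHom.mapMatrix_apply, Matrix.map_apply, Matrix.submatrix_apply]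
    rcases e i with a | a <;> rcases e j with b | b <;> simp [Matrix.one_apply, apply_ite]
  change (f M).rank = _
  rw [← Matrix.rank_mul_eq_right_of_isUnit_det _ (f M) hV',
    ← Matrix.rank_mul_eq_left_of_isUnit_det _ (f V * f M) hU', h2, Matrix.rank_submatrix]
  have : (Matrix.fromBlocks 1 0 0 0 : Matrix (Fin M.rank ⊕ Fin (Fintype.card m - M.rank)) _ ℂ)
     = Matrix.diagonal (Sum.elim (fun _ => 1) (fun _ => 0)) := by
    ext i j
    rcases i with a | a <;> rcases j with b | b <;> simp [Matrix.one_apply, Matrix.diagonal_apply]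
  rw [this, Matrix.rank_diagonal, Fintype.card_subtype, Finset.card_filter, Fintype.sum_sum_type]
  simp

noncomputable def fhat {p : ℕ} [NeZero p] (χ : DirichletCharacter ℂ p) : ℂ :=
  ∑ j : ZMod p, χ j⁻¹ * ((j.val : ℂ) / p)

lemma fhat_ne_zero_iff {p : ℕ} [Fact p.Prime] (hp2 : p ≠ 2) (χ : DirichletCharacter ℂ p) :
    fhat χ ≠ 0 ↔ χ = 1 ∨ χ.Odd := by
  have hp : p.Prime := Fact.out
  have e : fhat χ = ∑ j : ZMod p, χ⁻¹ j * ((j.val : ℂ) / p) := by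
    simp [fhat, MulChar.inv_apply']
  rw [e]
  have hpC : (p : ℂ) ≠ 0 := by exact_mod_cast hp.ne_zero
  have symm : ∀ ψ : DirichletCharacter ℂ p, ψ.Even →
      2 * ∑ j : ZMod p, ψ j * ((j.val : ℂ) / p) = ∑ j : ZMod p, ψ j := by
    intro ψ hψ
    have hev : ∀ j, ψ (-j) = ψ j := fun j => by
      rw [← neg_one_mul, map_mul, show ψ (-1) = 1 from hψ, one_mul]
    have : ∑ j : ZMod p, ψ j * ((j.val : ℂ) / p) = ∑ j : ZMod p, ψ j * (((-j).val : ℂ) / p) := by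
      refine Fintype.sum_equiv (Equiv.neg _) _ _ fun j => ?_
      simp [hev]
    rw [two_mul]
    nth_rw 2 [this]
    rw [← Finset.sum_add_distrib]
    refine Finset.sum_congr rfl fun j _ => ?_
    by_cases hj : j = 0
    · simp [hj, MulChar.map_zero]
    haveI : NeZero j := ⟨hj⟩
    rw [ZMod.val_neg_of_ne_zero, Nat.cast_sub (ZMod.val_lt j).le]
    field_simp
    ring
  constructor
  · intro h
    rcases χ.even_or_odd with hev | ho
    · left
      by_contra h1
      have hev' : χ⁻¹.Even := by
        change χ⁻¹ (-1) = 1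
        rw [MulChar.inv_apply', inv_neg_one]; exact hev
      have := symm _ hev'
      rw [MulChar.sum_eq_zero_of_ne_one (by simpa using h1)] at this
      exact h (by simpa using this)
    · exact Or.inr ho
  · rintro (rfl | ho)
    · have := symm (1 : DirichletCharacter ℂ p)⁻¹ (by
        rw [inv_one]; exact MulChar.one_apply (isUnit_one.neg))
      intro h0
      rw [h0, inv_one, MulChar.sum_one_eq_card_units, ZMod.card_units] at this
      have h3 := hp.two_le
      have : p - 1 = 0 := by
        have h4 : ((p - 1 : ℕ) : ℂ) = 0 := by simpa using this.symm
        exact_mod_cast h4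
      omega
    · apply bernoulli_ne_zero
      change χ⁻¹ (-1) = -1
      rw [MulChar.inv_apply', inv_neg_one]; exact ho

lemma count {p : ℕ} [Fact p.Prime] (hp2 : p ≠ 2) :
    Nat.card {χ : DirichletCharacter ℂ p // fhat χ ≠ 0} = (p + 1) / 2 := by
  classical
  have hp : p.Prime := Fact.out
  haveI : Fact (2 < p) := ⟨lt_of_le_of_ne hp.two_le (Ne.symm hp2)⟩
  obtain ⟨χ₀, h0⟩ := DirichletCharacter.exists_apply_ne_one_of_hasEnoughRootsOfUnity ℂ
    (n := p) (ZMod.neg_one_ne_one)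
  have ho : χ₀.Odd := χ₀.even_or_odd.resolve_left h0
  have ho1 : χ₀ (-1) = -1 := ho
  rw [Nat.card_eq_fintype_card, Fintype.card_subtype]
  let O := Finset.univ.filter (fun χ : DirichletCharacter ℂ p => χ (-1) = -1)
  let E := Finset.univ.filter (fun χ : DirichletCharacter ℂ p => ¬ χ (-1) = -1)
  have hOE : O.card = E.card := by
    refine Finset.card_bij (fun χ _ => χ₀ * χ) ?_ ?_ ?_
    · intro χ h
      simp only [O, E, Finset.mem_filter, Finset.mem_univ, true_and] at h ⊢
      rw [MulChar.mul_apply, h, ho1]; norm_num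
    · intro a _ b _ h
      exact mul_left_cancel h
    · intro χ h
      simp only [O, E, Finset.mem_filter, Finset.mem_univ, true_and] at h ⊢
      refine ⟨χ₀⁻¹ * χ, ?_, by simp⟩
      rw [MulChar.mul_apply, MulChar.inv_apply', inv_neg_one, ho1,
        show χ (-1) = 1 from χ.even_or_odd.resolve_right h]
      norm_num
  have hT : O.card + E.card = p - 1 := by
    rw [Finset.card_filter_add_card_filter_not, Finset.card_univ, ← Nat.card_eq_fintype_card,
      DirichletCharacter.card_eq_totient_of_hasEnoughRootsOfUnity, Nat.totient_prime hp]
  have hS : (Finset.univ.filter (fun χ : DirichletCharacter ℂ p => fhat χ ≠ 0)) = insert 1 O := by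
    ext χ
    simp only [Finset.mem_filter, Finset.mem_univ, true_and, Finset.mem_insert, O]
    exact fhat_ne_zero_iff hp2 χ
  rw [hS, Finset.card_insert_of_notMem]
  · obtain ⟨k, hk⟩ := hp.odd_of_ne_two hp2
    omega
  · simp only [Finset.mem_filter, Finset.mem_univ, true_and, O]
    exact fun h => odd_ne_one 1 h rfl

lemma rank_units {p : ℕ} [Fact p.Prime] (hp2 : p ≠ 2) :
    (Matrix.of fun a b : (ZMod p)ˣ => (((a * b : (ZMod p)ˣ) : ZMod p).val : ℂ) / p).rank
      = (p + 1) / 2 := by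
  classical
  have hp : p.Prime := Fact.out
  rw [← count hp2, Nat.card_eq_fintype_card, ← Matrix.rank_diagonal]
  set M := (Matrix.of fun a b : (ZMod p)ˣ => (((a * b : (ZMod p)ˣ) : ZMod p).val : ℂ) / p)
  set D := Matrix.diagonal (fhat (p := p))
  let X : Matrix (ZMod p)ˣ (DirichletCharacter ℂ p) ℂ := Matrix.of fun a χ => χ a
  let X' : Matrix (ZMod p)ˣ (DirichletCharacter ℂ p) ℂ := Matrix.of fun a χ => χ (a⁻¹ : (ZMod p)ˣ)
  let c : ℂ := ((p.totient : ℂ))⁻¹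
  have hc : c * p.totient = 1 := by
    apply inv_mul_cancel₀
    exact_mod_cast (Nat.totient_pos.2 hp.pos).ne'
  have hcard : Fintype.card (ZMod p)ˣ = Fintype.card (DirichletCharacter ℂ p) := by
    rw [← Nat.card_eq_fintype_card (α := DirichletCharacter ℂ p),
      DirichletCharacter.card_eq_totient_of_hasEnoughRootsOfUnity, ZMod.card_units_eq_totient]
  have h1 : X * (c • X'.transpose) = 1 := by
    ext a b
    rw [Matrix.mul_smul, Matrix.smul_apply, Matrix.mul_apply]
    simp only [X, X', Matrix.of_apply, Matrix.transpose_apply, ← map_mul, ← Units.val_mul]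
    rw [DirichletCharacter.sum_characters_eq, Matrix.one_apply]
    simp only [Units.val_eq_one, mul_inv_eq_one]
    split_ifs <;> simp [hc]
  have h2 : X' * (c • X.transpose) = 1 := by
    have := congrArg Matrix.transpose h1
    simpa [Matrix.transpose_mul] using this
  have h1' := (Matrix.mul_eq_one_comm_of_card_eq _ _ _ hcard).1 h1
  have hMX : M * X' = X * D := by
    ext a χ
    rw [Matrix.mul_diagonal, Matrix.mul_apply]
    simp only [M, X, X', Matrix.of_apply]
    have hf : fhat χ = ∑ u : (ZMod p)ˣ, χ (u⁻¹ : (ZMod p)ˣ) * (((u : ZMod p).val : ℂ) / p) := by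
      rw [fhat]
      symm
      refine Finset.sum_of_injOn (fun u : (ZMod p)ˣ => (u : ZMod p)) (fun _ _ _ _ h => Units.ext h)
        (by simp) ?_ ?_
      · intro j _ hj
        have : j = 0 := by
          by_contra h
          exact hj ⟨Units.mk0 j h, by simp, rfl⟩
        simp [this]
      · intro u _
        rw [Units.val_inv_eq_inv_val]
    rw [hf, Finset.mul_sum]
    refine Fintype.sum_equiv (Equiv.mulLeft a) _ _ fun b => ?_
    simp only [Equiv.coe_mulLeft]
    rw [← mul_assoc, ← map_mul, ← Units.val_mul, mul_inv, mul_inv_cancel_left, mul_comm]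
  apply le_antisymm
  · have : M = X * D * (c • X.transpose) := by
      rw [← hMX, Matrix.mul_assoc, h2, Matrix.mul_one]
    rw [this]
    exact (Matrix.rank_mul_le_left _ _).trans (Matrix.rank_mul_le_right _ _)
  · have : D = (c • X'.transpose) * (M * X') := by
      rw [hMX, ← Matrix.mul_assoc, h1', Matrix.one_mul]
    rw [this]
    exact (Matrix.rank_mul_le_right _ _).trans (Matrix.rank_mul_le_left _ _)

/-- For an odd prime `n`, the `(n-1) × (n-1)` matrix over `ℚ` with entries the fractional
parts `⟨ij/n⟩` (for `1 ≤ i, j ≤ n-1`) has rank `(n+1)/2`. -/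
theorem stmt_2 (n : ℕ) (hn : n.Prime) (hodd : Odd n)
    (A : Matrix (Fin (n - 1)) (Fin (n - 1)) ℚ)
    (hA : ∀ i j : Fin (n - 1),
      A i j = Int.fract ((((i.val + 1) * (j.val + 1) : ℕ) : ℚ) / (n : ℚ))) :
    A.rank = (n + 1) / 2 := by
  classical
  haveI : Fact n.Prime := ⟨hn⟩
  have hn2 : n ≠ 2 := by rintro rfl; exact absurd hodd (by decide)
  rw [← rank_units hn2, ← rank_map_complex]
  have hz : ∀ i : Fin (n - 1), ((i.val + 1 : ℕ) : ZMod n) ≠ 0 := by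
    intro i h
    rw [ZMod.natCast_eq_zero_iff] at h
    have := Nat.le_of_dvd (by omega) h
    have := i.2
    omega
  let φ : Fin (n - 1) → (ZMod n)ˣ := fun i => Units.mk0 _ (hz i)
  have hφ : Function.Bijective φ := by
    rw [Fintype.bijective_iff_injective_and_card]
    constructor
    · intro i j h
      have h' : ((i.val + 1 : ℕ) : ZMod n) = ((j.val + 1 : ℕ) : ZMod n) := congrArg Units.val h
      rw [ZMod.natCast_eq_natCast_iff', Nat.mod_eq_of_lt (by omega), Nat.mod_eq_of_lt (by omega)] at h'
      exact Fin.ext (by omega)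
    · rw [ZMod.card_units, Fintype.card_fin]
  let e := Equiv.ofBijective φ hφ
  rw [← Matrix.rank_submatrix _ e e]
  congr 1
  ext i j
  rw [Matrix.map_apply, hA, Matrix.submatrix_apply, Matrix.of_apply, Units.val_mul]
  change _ = (((((i.val + 1 : ℕ) : ZMod n) * ((j.val + 1 : ℕ) : ZMod n)).val : ℕ) : ℂ) / n
  rw [← Nat.cast_mul, ZMod.val_natCast]
  generalize (i.val + 1) * (j.val + 1) = k
  have : Int.fract ((k : ℚ) / n) = ((k % n : ℕ) : ℚ) / n := Int.fract_div_natCast_eq_div_natCast_mod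
  rw [this]
  simp
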